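/- For every n ≥ 5, the radio number of the wheel graph W_n equals n + 2, i.e., rn(W_n) = n + 2. -/

import Mathlib

/-- A radio labeling of a graph `G` is an injective assignment of positive
integers to the vertices such that `d(u,v) + |c(u) - c(v)| ≥ diam(G) + 1`
for all pairs of distinct vertices. -/
def IsRadioLabeling {V : Type*} [Fintype V] (G : SimpleGraph V) (c : V → ℕ) : Prop :=
  Function.Injective c ∧ (∀ v, 1 ≤ c v) ∧
    ∀ u v : V, u ≠ v →
      (G.diam : ℤ) + 1 ≤ (G.dist u v : ℤ) + |(c u : ℤ) - (c v : ℤ)|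

/-- The radio number of `G`: the least possible span (maximum label used)
of a radio labeling of `G`. -/
noncomputable def radioNumber {V : Type*} [Fintype V] (G : SimpleGraph V) : ℕ :=
  sInf {s : ℕ | ∃ c : V → ℕ, IsRadioLabeling G c ∧ s = Finset.univ.sup c}

/-- The wheel graph `W_n`: an `n`-cycle (vertices `some i`) together with a
center vertex `none` adjacent to all cycle vertices. -/
def wheelGraph (n : ℕ) : SimpleGraph (Option (Fin n)) :=
  SimpleGraph.fromRel (fun u v =>
    u = none ∨ ∃ i j : Fin n, u = some i ∧ v = some j ∧ (i.val + 1) % n = j.val)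

lemma wheel_adj_none {n : ℕ} (i : Fin n) : (wheelGraph n).Adj none (some i) := by
  simp [wheelGraph]

lemma wheel_adj_some {n : ℕ} (i j : Fin n) : (wheelGraph n).Adj (some i) (some j) ↔
    i ≠ j ∧ ((i.val + 1) % n = j.val ∨ (j.val + 1) % n = i.val) := by
  simp [wheelGraph]

lemma wheel_walk {n : ℕ} (u v : Option (Fin n)) :
    ∃ p : (wheelGraph n).Walk u v, p.length ≤ 2 := by
  rcases u with _ | i <;> rcases v with _ | j
  · exact ⟨.nil, by simp⟩
  · exact ⟨.cons (wheel_adj_none j) .nil, by simp⟩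
  · exact ⟨.cons (wheel_adj_none i).symm .nil, by simp⟩
  · exact ⟨.cons (wheel_adj_none i).symm (.cons (wheel_adj_none j) .nil), by simp⟩

lemma wheel_conn (n : ℕ) : (wheelGraph n).Connected where
  preconnected u v := ⟨(wheel_walk u v).choose⟩
  nonempty := ⟨none⟩

lemma wheel_dist_le {n : ℕ} (u v : Option (Fin n)) : (wheelGraph n).dist u v ≤ 2 := by
  obtain ⟨p, hp⟩ := wheel_walk u v
  exact (SimpleGraph.dist_le p).trans hp

lemma wheel_dist_pos {n : ℕ} {u v : Option (Fin n)} (h : u ≠ v) :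
    1 ≤ (wheelGraph n).dist u v := (wheel_conn n).pos_dist_of_ne h

lemma wheel_dist_two {n : ℕ} {u v : Option (Fin n)} (h : u ≠ v)
    (h' : ¬ (wheelGraph n).Adj u v) : (wheelGraph n).dist u v = 2 := by
  have h1 := wheel_dist_le u v
  have h2 := wheel_dist_pos h
  have h3 : (wheelGraph n).dist u v ≠ 1 := fun h => h' (SimpleGraph.dist_eq_one_iff_adj.1 h)
  omega

lemma wheel_nonadj {n : ℕ} {i j : Fin n} (h : i.val + 2 ≤ j.val) (h' : j.val + 2 ≤ i.val + n) :
    ¬ (wheelGraph n).Adj (some i) (some j) := by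
  rw [wheel_adj_some]
  rintro ⟨-, h1 | h1⟩
  · rw [Nat.mod_eq_of_lt (by omega)] at h1; omega
  · rcases Nat.lt_or_ge (j.val + 1) n with h2 | h2
    · rw [Nat.mod_eq_of_lt h2] at h1; omega
    · have : j.val + 1 = n := by omega
      rw [this, Nat.mod_self] at h1; omega

lemma wheel_diam {n : ℕ} (hn : 5 ≤ n) : (wheelGraph n).diam = 2 := by
  have : Nonempty (Option (Fin n)) := ⟨none⟩
  apply le_antisymm
  · obtain ⟨u, v, h⟩ := (wheelGraph n).exists_dist_eq_diam
    exact h ▸ wheel_dist_le u v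
  · have h : (wheelGraph n).dist (some ⟨0, by omega⟩) (some ⟨2, by omega⟩) = 2 := by
      apply wheel_dist_two (by simp)
      apply wheel_nonadj <;> simp; omega
    rw [← h]
    apply SimpleGraph.dist_le_diam
    exact SimpleGraph.connected_iff_ediam_ne_top.1 (wheel_conn n)

lemma wheel_lower {n : ℕ} (hn : 5 ≤ n) {c : Option (Fin n) → ℕ}
    (hc : IsRadioLabeling (wheelGraph n) c) : n + 2 ≤ Finset.univ.sup c := by
  obtain ⟨hi, hp, hd⟩ := hc
  by_contra hlt
  have hle : ∀ v, c v ≤ n + 1 := fun v => by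
    have := Finset.le_sup (f := c) (Finset.mem_univ v); omega
  have himg : Finset.univ.image c = Finset.Icc 1 (n + 1) := by
    apply Finset.eq_of_subset_of_card_le
    · intro x hx
      obtain ⟨v, -, rfl⟩ := Finset.mem_image.1 hx
      exact Finset.mem_Icc.2 ⟨hp v, hle v⟩
    · rw [Finset.card_image_of_injective _ hi]; simp
  have key : ∀ x, 1 ≤ x → x ≤ n + 1 → x ≠ c none →
      (2 : ℤ) ≤ |(c none : ℤ) - (x : ℤ)| := by
    intro x h1 h2 h3
    have : x ∈ Finset.univ.image c := himg ▸ Finset.mem_Icc.2 ⟨h1, h2⟩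
    obtain ⟨v, -, rfl⟩ := Finset.mem_image.1 this
    rcases v with _ | i
    · exact absurd rfl h3
    · have := hd none (some i) (by simp)
      rw [wheel_diam hn, SimpleGraph.dist_eq_one_iff_adj.2 (wheel_adj_none i)] at this
      push_cast at this
      linarith
  have h0 := hp none
  have h1 := hle none
  rcases Nat.lt_or_ge (c none) 2 with h | h
  · have := key (c none + 1) (by omega) (by omega) (by omega)
    push_cast at this
    rw [le_abs] at this; omega
  · have := key (c none - 1) (by omega) (by omega) (by omega)
    rw [le_abs] at this; omega

/-- The optimal labeling: center gets 1, then the even and then the odd cycle vertices. -/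
def wheelLabel (n : ℕ) : Option (Fin n) → ℕ
  | none => 1
  | some i => if i.val % 2 = 0 then 3 + i.val / 2 else 3 + (n + 1) / 2 + i.val / 2

lemma wheelLabel_pair {n : ℕ} (hn : 5 ≤ n) {u v : Option (Fin n)} (h : u ≠ v)
    (hl : wheelLabel n u ≤ wheelLabel n v) :
    wheelLabel n u + 3 ≤ wheelLabel n v + (wheelGraph n).dist u v ∧
    wheelLabel n u < wheelLabel n v := by
  have hpos := wheel_dist_pos h
  rcases u with _ | i <;> rcases v with _ | j
  · exact absurd rfl h
  · simp only [wheelLabel] at *; split_ifs <;> omega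
  · simp only [wheelLabel] at *; split_ifs at * <;> omega
  · have hij : i.val ≠ j.val := fun e => h (by rw [Fin.ext e])
    have hI := i.isLt
    have hJ := j.isLt
    have hlt : wheelLabel n (some i) < wheelLabel n (some j) := by
      simp only [wheelLabel] at *; split_ifs at * <;> omega
    refine ⟨?_, hlt⟩
    by_cases h2 : wheelLabel n (some i) + 2 ≤ wheelLabel n (some j)
    · omega
    have hd : (wheelGraph n).dist (some i) (some j) = 2 := by
      apply wheel_dist_two h
      have : (i.val + 2 ≤ j.val ∧ j.val + 2 ≤ i.val + n) ∨
          (j.val + 2 ≤ i.val ∧ i.val + 2 ≤ j.val + n) := by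
        simp only [wheelLabel] at *; split_ifs at * <;> omega
      rcases this with ⟨a, b⟩ | ⟨a, b⟩
      · exact wheel_nonadj a b
      · exact fun e => wheel_nonadj a b e.symm
    omega

lemma wheelLabel_radio {n : ℕ} (hn : 5 ≤ n) :
    IsRadioLabeling (wheelGraph n) (wheelLabel n) := by
  refine ⟨?_, ?_, ?_⟩
  · intro u v huv
    by_contra h
    have := (wheelLabel_pair hn h huv.le).2
    omega
  · rintro (_ | i)
    · simp [wheelLabel]
    · simp only [wheelLabel]; split_ifs <;> omega
  · intro u v h
    rw [wheel_diam hn]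
    rcases le_total (wheelLabel n u) (wheelLabel n v) with hl | hl
    · have := (wheelLabel_pair hn h hl).1
      have := neg_abs_le ((wheelLabel n u : ℤ) - wheelLabel n v)
      push_cast; omega
    · have := (wheelLabel_pair hn h.symm hl).1
      rw [SimpleGraph.dist_comm] at this
      have := le_abs_self ((wheelLabel n u : ℤ) - wheelLabel n v)
      push_cast; omega

/-- For `n ≥ 5`, the radio number of the wheel `W_n` is `n + 2`. -/
theorem radioNumber_wheel (n : ℕ) (hn : 5 ≤ n) :
    radioNumber (wheelGraph n) = n + 2 := by
  apply le_antisymm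
  · apply Nat.sInf_le
    refine ⟨wheelLabel n, wheelLabel_radio hn, ?_⟩
    apply le_antisymm (wheel_lower hn (wheelLabel_radio hn))
    apply Finset.sup_le
    rintro (_ | i) -
    · simp [wheelLabel]
    · have := i.isLt
      simp only [wheelLabel]; split_ifs <;> omega
  · apply le_csInf
    · exact ⟨_, wheelLabel n, wheelLabel_radio hn, rfl⟩
    · rintro s ⟨c, hc, rfl⟩
      exact wheel_lower hn hc
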